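/- arXiv:1007.5295 — 2 statements merged into one kernel-verified Lean document; each statement's English description precedes it below -/
import Mathlib

section
/- The expansions of δ₂ and ε₂ in powers of q^{1/2} have the form δ₂(τ) = −1/8 − 3q^{1/2} − 3q + Σ_{n≥3} c_n q^{n/2} and ε₂(τ) = q^{1/2} + 8q + Σ_{n≥3} d_n q^{n/2} (valid for all τ ∈ ℍ, with the series absolutely convergent, q^{n/2} = e^{πinτ}), where all the higher coefficients c_n, d_n are integers. -/
open Complex

noncomputable section

/-- `q^s = e^{2πisτ}`. -/
def qpow (s τ : ℂ) : ℂ := Complex.exp (2 * (Real.pi : ℂ) * Complex.I * s * τ)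

/-- The Jacobi theta function `θ(v, τ)`, defined by its infinite product. -/
def jTheta (v τ : ℂ) : ℂ :=
  2 * qpow (1/8) τ * Complex.sin ((Real.pi : ℂ) * v) *
    ∏' j : ℕ, ((1 - qpow ((j : ℂ) + 1) τ)
      * (1 - Complex.exp (2 * (Real.pi : ℂ) * Complex.I * v) * qpow ((j : ℂ) + 1) τ)
      * (1 - Complex.exp (-(2 * (Real.pi : ℂ) * Complex.I * v)) * qpow ((j : ℂ) + 1) τ))

/-- The Jacobi theta function `θ₁(v, τ)`, defined by its infinite product. -/
def jTheta1 (v τ : ℂ) : ℂ :=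
  2 * qpow (1/8) τ * Complex.cos ((Real.pi : ℂ) * v) *
    ∏' j : ℕ, ((1 - qpow ((j : ℂ) + 1) τ)
      * (1 + Complex.exp (2 * (Real.pi : ℂ) * Complex.I * v) * qpow ((j : ℂ) + 1) τ)
      * (1 + Complex.exp (-(2 * (Real.pi : ℂ) * Complex.I * v)) * qpow ((j : ℂ) + 1) τ))

/-- The Jacobi theta function `θ₂(v, τ)`, defined by its infinite product
(the `j`-th factor involves `q^{j+1-1/2}`). -/
def jTheta2 (v τ : ℂ) : ℂ :=
  ∏' j : ℕ, ((1 - qpow ((j : ℂ) + 1) τ)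
    * (1 - Complex.exp (2 * (Real.pi : ℂ) * Complex.I * v) * qpow ((j : ℂ) + 1/2) τ)
    * (1 - Complex.exp (-(2 * (Real.pi : ℂ) * Complex.I * v)) * qpow ((j : ℂ) + 1/2) τ))

/-- The Jacobi theta function `θ₃(v, τ)`, defined by its infinite product. -/
def jTheta3 (v τ : ℂ) : ℂ :=
  ∏' j : ℕ, ((1 - qpow ((j : ℂ) + 1) τ)
    * (1 + Complex.exp (2 * (Real.pi : ℂ) * Complex.I * v) * qpow ((j : ℂ) + 1/2) τ)
    * (1 + Complex.exp (-(2 * (Real.pi : ℂ) * Complex.I * v)) * qpow ((j : ℂ) + 1/2) τ))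

/-- `θ'(0, τ)`: the partial derivative of `θ(v, τ)` in `v`, evaluated at `v = 0`. -/
def jThetaDeriv (τ : ℂ) : ℂ := deriv (fun v => jTheta v τ) 0

/-- `δ₂(τ) = -(1/8)(θ₁(0,τ)⁴ + θ₃(0,τ)⁴)`. -/
def delta2 (τ : ℂ) : ℂ := -(1/8) * (jTheta1 0 τ ^ 4 + jTheta3 0 τ ^ 4)

/-- `ε₂(τ) = (1/16)θ₁(0,τ)⁴θ₃(0,τ)⁴`. -/
def epsilon2 (τ : ℂ) : ℂ := (1/16) * (jTheta1 0 τ ^ 4 * jTheta3 0 τ ^ 4)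

section Expansions

open Filter Topology Polynomial

/-- The power series `φ` with integer coefficients converges to `f` on the open unit disc. -/
def HasIntExpansion (φ : PowerSeries ℤ) (f : ℂ → ℂ) : Prop :=
  ∀ x : ℂ, ‖x‖ < 1 → HasSum (fun n : ℕ => (φ.coeff n : ℂ) * x ^ n) (f x)

namespace HasIntExpansion

variable {φ ψ : PowerSeries ℤ} {f g : ℂ → ℂ}

lemma add (hf : HasIntExpansion φ f) (hg : HasIntExpansion ψ g) :
    HasIntExpansion (φ + ψ) (f + g) := fun x hx => by
  simpa [add_mul] using! (hf x hx).add (hg x hx)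

lemma mul (hf : HasIntExpansion φ f) (hg : HasIntExpansion ψ g) :
    HasIntExpansion (φ * ψ) (f * g) := fun x hx => by
  have hfs := (hf x hx).summable.norm
  have hgs := (hg x hx).summable.norm
  have key := (summable_norm_sum_mul_antidiagonal_of_summable_norm hfs hgs).of_norm.hasSum
  rw [← tsum_mul_tsum_eq_tsum_sum_antidiagonal_of_summable_norm hfs hgs, (hf x hx).tsum_eq,
    (hg x hx).tsum_eq] at key
  refine key.congr_fun fun n => ?_
  rw [PowerSeries.coeff_mul]
  push_cast
  rw [Finset.sum_mul]
  refine Finset.sum_congr rfl fun kl hkl => ?_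
  rw [← Finset.HasAntidiagonal.mem_antidiagonal.mp hkl]
  ring

lemma intCast (k : ℤ) : HasIntExpansion (PowerSeries.C k) (fun _ => (k : ℂ)) := fun x _ => by
  convert hasSum_single (f := fun n : ℕ => ((PowerSeries.coeff n (PowerSeries.C k) : ℤ) : ℂ) * x ^ n)
    0 fun n hn => by rw [PowerSeries.coeff_C, if_neg hn]; simp using 1
  simp

lemma id : HasIntExpansion PowerSeries.X (fun x => x) := fun x _ => by
  convert hasSum_single
    (f := fun n : ℕ => ((PowerSeries.coeff n (PowerSeries.X : PowerSeries ℤ) : ℤ) : ℂ) * x ^ n)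
    1 fun n hn => by simp [PowerSeries.coeff_X, hn] using 1
  simp

lemma pow (hf : HasIntExpansion φ f) (k : ℕ) : HasIntExpansion (φ ^ k) (f ^ k) := by
  induction k with
  | zero => simpa using! intCast 1
  | succ k ih => simpa [pow_succ] using ih.mul hf

lemma hasSum_tail (hf : HasIntExpansion φ f) {x : ℂ} (hx : ‖x‖ < 1) :
    HasSum (fun n : ℕ => (φ.coeff (n + 3) : ℂ) * x ^ (n + 3))
      (f x - (φ.coeff 0 + φ.coeff 1 * x + φ.coeff 2 * x ^ 2)) := by
  simpa [Finset.sum_range_succ] using! (hasSum_nat_add_iff' 3).mpr (hf x hx)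

end HasIntExpansion

lemma iterate_deriv_aeval (p : ℤ[X]) (n : ℕ) :
    deriv^[n] (fun x : ℂ => aeval x p) = fun x => aeval x (derivative^[n] p) := by
  induction n generalizing p with
  | zero => rfl
  | succ n ih =>
    rw [Function.iterate_succ_apply, Function.iterate_succ_apply, ← ih]
    congr 1
    funext x
    exact Polynomial.deriv_aeval p

/-- A locally uniform limit on the unit disc of integer polynomials has an expansion with integer
coefficients, which are the eventual values of the coefficients of the polynomials. -/
lemma exists_hasIntExpansion {p : ℕ → ℤ[X]} {f : ℂ → ℂ}
    (h : TendstoLocallyUniformlyOn (fun N x => aeval x (p N)) f atTop (Metric.ball (0 : ℂ) 1)) :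
    ∃ φ : PowerSeries ℤ, HasIntExpansion φ f ∧ ∀ n, ∀ᶠ N in atTop, (p N).coeff n = φ.coeff n := by
  have hiter : ∀ n : ℕ, TendstoLocallyUniformlyOn (fun N x => aeval x (derivative^[n] (p N)))
      (deriv^[n] f) atTop (Metric.ball (0 : ℂ) 1) := by
    intro n
    induction n with
    | zero => exact h
    | succ n ih =>
      have := ih.deriv (.of_forall fun N => (Polynomial.differentiable_aeval _).differentiableOn)
        Metric.isOpen_ball
      simp only [Function.iterate_succ_apply']
      refine this.congr fun N x _ => ?_
      exact Polynomial.deriv_aeval _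
  have hcoeff : ∀ n : ℕ, ∃ a : ℤ, (∀ᶠ N in atTop, (p N).coeff n = a) ∧
      iteratedDeriv n f 0 = n.factorial * a := by
    intro n
    have h0 : Tendsto (fun N => aeval (0 : ℂ) (derivative^[n] (p N))) atTop
        (𝓝 (deriv^[n] f 0)) := (hiter n).tendsto_at (by simp)
    have h1 : ∀ N, aeval (0 : ℂ) (derivative^[n] (p N)) =
        ((n.factorial * (p N).coeff n : ℤ) : ℂ) := by
      intro N
      rw [← Polynomial.coeff_zero_eq_aeval_zero', Polynomial.coeff_iterate_derivative]
      simp [Nat.descFactorial_self]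
    have hfac : (n.factorial : ℂ) ≠ 0 := by exact_mod_cast n.factorial_ne_zero
    have h2 : Tendsto (fun N => (((p N).coeff n : ℤ) : ℂ)) atTop
        (𝓝 (deriv^[n] f 0 / n.factorial)) := by
      refine (h0.div_const (n.factorial : ℂ)).congr fun N => ?_
      rw [h1]
      push_cast
      field_simp
    have hcl : IsClosedEmbedding ((↑) : ℤ → ℂ) := Complex.isClosedEmbedding_intCast
    obtain ⟨a, ha⟩ := hcl.isClosed_range.mem_of_tendsto h2 (.of_forall fun N => ⟨_, rfl⟩)
    refine ⟨a, ?_, ?_⟩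
    · rw [← ha] at h2
      have := (hcl.isInducing.tendsto_nhds_iff (f := fun N => (p N).coeff n)).mpr h2
      simpa [nhds_discrete] using this
    · rw [iteratedDeriv_eq_iterate, ha]
      field_simp
  choose a ha ha' using hcoeff
  refine ⟨PowerSeries.mk a, fun x hx => ?_, by simpa using ha⟩
  have hd : DifferentiableOn ℂ f (Metric.ball 0 1) := h.differentiableOn
    (.of_forall fun N => (Polynomial.differentiable_aeval _).differentiableOn) Metric.isOpen_ball
  have := Complex.hasSum_taylorSeries_on_ball (r := 1) (by simpa using! hd)
    (by simpa using hx : x ∈ Metric.ball (0 : ℂ) 1)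
  refine this.congr_fun fun n => ?_
  have hfac : (n.factorial : ℂ) ≠ 0 := by exact_mod_cast n.factorial_ne_zero
  simp only [PowerSeries.coeff_mk, ha', sub_zero, smul_eq_mul]
  field_simp

lemma norm_triple_mul_sub_one_le {a b c : ℂ} {r : ℝ} (hr : r ≤ 1) (ha : ‖a‖ ≤ r) (hb : ‖b‖ ≤ r)
    (hc : ‖c‖ ≤ r) : ‖(1 + a) * (1 + b) * (1 + c) - 1‖ ≤ 7 * r := by
  have hr0 : 0 ≤ r := (norm_nonneg a).trans ha
  have h1 : ‖a * b‖ ≤ r := by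
    rw [norm_mul]; nlinarith [norm_nonneg a, norm_nonneg b]
  have h2 : ‖a * c‖ ≤ r := by
    rw [norm_mul]; nlinarith [norm_nonneg a, norm_nonneg c]
  have h3 : ‖b * c‖ ≤ r := by
    rw [norm_mul]; nlinarith [norm_nonneg b, norm_nonneg c]
  have h4 : ‖a * b * c‖ ≤ r := by
    rw [norm_mul]; nlinarith [norm_nonneg (a * b), norm_nonneg c]
  calc ‖(1 + a) * (1 + b) * (1 + c) - 1‖
      = ‖a + b + c + a * b + a * c + b * c + a * b * c‖ := by ring_nf
    _ ≤ ‖a‖ + ‖b‖ + ‖c‖ + ‖a * b‖ + ‖a * c‖ + ‖b * c‖ + ‖a * b * c‖ := by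
      repeat' first | exact le_rfl | refine (norm_add_le _ _).trans (add_le_add_left ?_ _)
    _ ≤ 7 * r := by linarith

lemma tendstoLocallyUniformlyOn_prod {a b c : ℕ → ℤ[X]}
    (ha : ∀ j, ∀ x : ℂ, ‖x‖ < 1 → ‖aeval x (a j)‖ ≤ ‖x‖ ^ j)
    (hb : ∀ j, ∀ x : ℂ, ‖x‖ < 1 → ‖aeval x (b j)‖ ≤ ‖x‖ ^ j)
    (hc : ∀ j, ∀ x : ℂ, ‖x‖ < 1 → ‖aeval x (c j)‖ ≤ ‖x‖ ^ j) :
    TendstoLocallyUniformlyOn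
      (fun N x => aeval x (∏ j ∈ Finset.range N, ((1 + a j) * (1 + b j) * (1 + c j))))
      (fun x => ∏' j, aeval x ((1 + a j) * (1 + b j) * (1 + c j))) atTop
      (Metric.ball (0 : ℂ) 1) := by
  set u : ℕ → ℤ[X] := fun j => (1 + a j) * (1 + b j) * (1 + c j) - 1 with hu
  have hprod : HasProdLocallyUniformlyOn (fun j (x : ℂ) => 1 + aeval x (u j))
      (fun x => ∏' j, (1 + aeval x (u j))) (Metric.ball (0 : ℂ) 1) := by
    refine hasProdLocallyUniformlyOn_of_forall_compact Metric.isOpen_ball fun K hK hKc => ?_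
    obtain ⟨r, hr0, hr1, hr⟩ : ∃ r : ℝ, 0 ≤ r ∧ r < 1 ∧ ∀ x ∈ K, ‖x‖ ≤ r := by
      rcases K.eq_empty_or_nonempty with rfl | hne
      · exact ⟨0, le_rfl, one_pos, by simp⟩
      · obtain ⟨y, hy, hmax⟩ := hKc.exists_isMaxOn hne continuous_norm.continuousOn
        exact ⟨‖y‖, norm_nonneg _, by simpa using hK hy, fun x hx => hmax hx⟩
    refine Summable.hasProdUniformlyOn_nat_one_add hKc
      ((summable_geometric_of_lt_one hr0 hr1).mul_left 7) (.of_forall fun j x hx => ?_)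
      fun j => (Polynomial.continuous_aeval _).continuousOn
    have hx1 : ‖x‖ < 1 := (hr x hx).trans_lt hr1
    have hpow : ‖x‖ ^ j ≤ r ^ j := by gcongr; exact hr x hx
    simpa [hu] using norm_triple_mul_sub_one_le (pow_le_one₀ hr0 hr1.le)
      ((ha j x hx1).trans hpow) ((hb j x hx1).trans hpow) ((hc j x hx1).trans hpow)
  have := hprod.tendstoLocallyUniformlyOn_finsetRange
  simpa [hu, map_prod] using this

lemma dvd_prod_sub_zero {R : Type*} [CommRing R] {d : R} {f : ℕ → R}
    (h : ∀ j, d ∣ f (j + 1) - 1) (N : ℕ) : d ∣ ∏ j ∈ Finset.range (N + 1), f j - f 0 := by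
  induction N with
  | zero => simp
  | succ N ih =>
    rw [Finset.prod_range_succ]
    have := ((h N).mul_left (∏ j ∈ Finset.range (N + 1), f j)).add ih
    convert this using 1
    ring

lemma dvd_prod_sub_prod {R : Type*} [CommRing R] {d : R} {f g : ℕ → R}
    (h : ∀ j, d ∣ f j - g j) (N : ℕ) :
    d ∣ ∏ j ∈ Finset.range N, f j - ∏ j ∈ Finset.range N, g j := by
  induction N with
  | zero => simp
  | succ N ih =>
    rw [Finset.prod_range_succ, Finset.prod_range_succ]
    have := (ih.mul_right (f N)).add ((h N).mul_left (∏ j ∈ Finset.range N, g j))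
    convert this using 1
    ring

lemma dvd_triple_mul_sub_one {R : Type*} [CommRing R] {d a b c : R} (ha : d ∣ a) (hb : d ∣ b)
    (hc : d ∣ c) : d ∣ (1 + a) * (1 + b) * (1 + c) - 1 := by
  have := ((ha.add hb).add (hc.add (ha.mul_right b))).add
    ((ha.mul_right c).add ((hb.mul_right c).add (ha.mul_right (b * c))))
  convert this using 1
  ring

lemma norm_pow_le_pow_of_le {x : ℂ} (hx : ‖x‖ < 1) {j m : ℕ} (h : j ≤ m) :
    ‖x ^ m‖ ≤ ‖x‖ ^ j := by
  rw [norm_pow]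
  exact pow_le_pow_of_le_one (norm_nonneg _) hx.le h

lemma prod_one_add_mul_one_sub_mul_prod_one_sub {R : Type*} [CommRing R] (y : R) (N : ℕ) :
    (∏ j ∈ Finset.range N, (1 + y ^ (j + 1)) * (1 - y ^ (2 * j + 1))) *
      ∏ j ∈ Finset.range N, (1 - y ^ (j + 1)) = ∏ j ∈ Finset.range (2 * N), (1 - y ^ (j + 1)) := by
  induction N with
  | zero => simp
  | succ N ih =>
    rw [show 2 * (N + 1) = 2 * N + 1 + 1 by ring]
    simp only [Finset.prod_range_succ]
    rw [← ih]
    ring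

/-- Euler's identity `∏ (1 + y^j) (1 - y^(2j-1)) = 1`. -/
lemma tendsto_prod_one_add_mul_one_sub {y : ℂ} (hy : ‖y‖ < 1) :
    Tendsto (fun N => ∏ j ∈ Finset.range N, (1 + y ^ (j + 1)) * (1 - y ^ (2 * j + 1))) atTop
      (𝓝 1) := by
  have hs : Summable fun j : ℕ => ‖-y ^ (j + 1)‖ := by
    simpa using! (summable_nat_add_iff 1).mpr (summable_geometric_of_lt_one (norm_nonneg _) hy)
  have hne (j : ℕ) : 1 + -y ^ (j + 1) ≠ 0 := by
    intro h
    have h1 : y ^ (j + 1) = 1 := by linear_combination -h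
    have h2 : ‖y‖ ^ (j + 1) < 1 := pow_lt_one₀ (norm_nonneg _) hy (by simp)
    rw [← norm_pow, h1] at h2
    simp at h2
  have hQ : Tendsto (fun N => ∏ j ∈ Finset.range N, (1 - y ^ (j + 1))) atTop
      (𝓝 (∏' j : ℕ, (1 + -y ^ (j + 1)))) := by
    simpa [sub_eq_add_neg] using (multipliable_one_add_of_summable hs).hasProd.tendsto_prod_nat
  have hQ0 : ∏' j : ℕ, (1 + -y ^ (j + 1)) ≠ 0 := tprod_one_add_ne_zero_of_summable hne hs
  have hQ2 := hQ.comp (tendsto_id.const_mul_atTop' (r := 2) (by norm_num))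
  have := hQ2.div hQ hQ0
  rw [div_self hQ0] at this
  refine this.congr fun N => ?_
  have hN : ∏ j ∈ Finset.range N, (1 - y ^ (j + 1)) ≠ 0 :=
    Finset.prod_ne_zero_iff.mpr fun j _ => by simpa [sub_eq_add_neg] using hne j
  simp only [Pi.div_apply, Function.comp_apply, _root_.id]
  rw [← prod_one_add_mul_one_sub_mul_prod_one_sub, mul_div_cancel_right₀ _ hN]

/-- The infinite product for `θ₃(0, τ)` in terms of `x = q^{1/2}`. -/
def theta3Prod (x : ℂ) : ℂ := ∏' j : ℕ, (1 - x ^ (2 * j + 2)) * (1 + x ^ (2 * j + 1)) ^ 2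

/-- The infinite product for `θ₁(0, τ) / (2 q^{1/8})` in terms of `x = q^{1/2}`. -/
def theta1Prod (x : ℂ) : ℂ := ∏' j : ℕ, (1 - x ^ (2 * j + 2)) * (1 + x ^ (2 * j + 2)) ^ 2

lemma exists_hasIntExpansion_theta1Prod :
    ∃ φ : PowerSeries ℤ, HasIntExpansion φ theta1Prod ∧ φ.coeff 0 = 1 ∧ φ.coeff 1 = 0 := by
  have h := tendstoLocallyUniformlyOn_prod (a := fun j => -X ^ (2 * j + 2))
    (b := fun j => X ^ (2 * j + 2)) (c := fun j => X ^ (2 * j + 2))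
    (fun j x hx => by simpa using norm_pow_le_pow_of_le hx (by lia : j ≤ 2 * j + 2))
    (fun j x hx => by simpa using norm_pow_le_pow_of_le hx (by lia : j ≤ 2 * j + 2))
    (fun j x hx => by simpa using norm_pow_le_pow_of_le hx (by lia : j ≤ 2 * j + 2))
  obtain ⟨φ, hφ, hcoeff⟩ := exists_hasIntExpansion h
  have hX (j : ℕ) : (X : ℤ[X]) ^ 2 ∣ X ^ (2 * j + 2) := pow_dvd_pow _ (by lia)
  have hdvd (N : ℕ) : (X : ℤ[X]) ^ 2 ∣ ∏ j ∈ Finset.range N,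
      ((1 + -X ^ (2 * j + 2)) * (1 + X ^ (2 * j + 2)) * (1 + X ^ (2 * j + 2))) - 1 := by
    simpa using dvd_prod_sub_prod (g := fun _ => (1 : ℤ[X]))
      (fun j => dvd_triple_mul_sub_one (hX j).neg_right (hX j) (hX j)) N
  have hk (k : ℕ) (hk2 : k < 2) : φ.coeff k = (1 : ℤ[X]).coeff k := by
    obtain ⟨N, hN⟩ := (hcoeff k).exists
    have := X_pow_dvd_iff.mp (hdvd N) k hk2
    rw [coeff_sub, hN] at this
    linarith
  refine ⟨φ, ?_, by simpa using hk 0 (by simp), by simpa [coeff_one] using hk 1 (by simp)⟩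
  convert hφ using 1
  funext x
  simp [theta1Prod, sub_eq_add_neg, mul_assoc, pow_two]

lemma exists_hasIntExpansion_theta3Prod :
    ∃ (g : ℂ → ℂ) (ψ : PowerSeries ℤ), HasIntExpansion ψ g ∧
      (∀ x : ℂ, ‖x‖ < 1 → theta3Prod x = 1 + 2 * g x) ∧
      ψ.coeff 0 = 0 ∧ ψ.coeff 1 = 1 ∧ ψ.coeff 2 = 0 := by
  have hp := tendstoLocallyUniformlyOn_prod (a := fun j => -X ^ (2 * j + 2))
    (b := fun j => X ^ (2 * j + 1)) (c := fun j => X ^ (2 * j + 1))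
    (fun j x hx => by simpa using norm_pow_le_pow_of_le hx (by lia : j ≤ 2 * j + 2))
    (fun j x hx => by simpa using norm_pow_le_pow_of_le hx (by lia : j ≤ 2 * j + 1))
    (fun j x hx => by simpa using norm_pow_le_pow_of_le hx (by lia : j ≤ 2 * j + 1))
  have he := tendstoLocallyUniformlyOn_prod (a := fun j => X ^ (2 * j + 2))
    (b := fun j => -X ^ (4 * j + 2)) (c := fun _ => 0)
    (fun j x hx => by simpa using norm_pow_le_pow_of_le hx (by lia : j ≤ 2 * j + 2))
    (fun j x hx => by simpa using norm_pow_le_pow_of_le hx (by lia : j ≤ 4 * j + 2))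
    (fun j x hx => by simp)
  set p : ℕ → ℤ[X] := fun j =>
    (1 + -X ^ (2 * j + 2)) * (1 + X ^ (2 * j + 1)) * (1 + X ^ (2 * j + 1)) with hp_def
  set e : ℕ → ℤ[X] := fun j => (1 + X ^ (2 * j + 2)) * (1 + -X ^ (4 * j + 2)) * (1 + 0) with he_def
  have hpe (j : ℕ) : 2 ∣ p j - e j := by
    refine ⟨X ^ (2 * j + 1) - X ^ (2 * j + 2) - X ^ (2 * j + 1) * X ^ (2 * j + 2)
      + X ^ (2 * j + 1) * X ^ (2 * j + 1), ?_⟩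
    simp only [hp_def, he_def]
    ring
  choose t ht using dvd_prod_sub_prod hpe
  have hE (x : ℂ) (hx : ‖x‖ < 1) : ∏' j, aeval x (e j) = 1 := by
    refine tendsto_nhds_unique (he.tendsto_at (by simpa using hx)) ?_
    have hx2 : ‖x ^ 2‖ < 1 := by
      rw [norm_pow]; exact pow_lt_one₀ (norm_nonneg _) hx (by simp)
    refine (tendsto_prod_one_add_mul_one_sub hx2).congr fun N => ?_
    rw [map_prod]
    refine Finset.prod_congr rfl fun j _ => ?_
    simp
    ring
  have ht_lim : TendstoLocallyUniformlyOn (fun N x => aeval x (t N))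
      (fun x => (1 / 2) * (theta3Prod x - 1)) atTop (Metric.ball (0 : ℂ) 1) := by
    have h1 := (uniformContinuous_const_smul (1 / 2 : ℂ)).comp_tendstoLocallyUniformlyOn (hp.sub he)
    refine (h1.congr fun N x _ => ?_).congr_right fun x hx => ?_
    · have := congrArg (aeval x) (ht N)
      simp only [map_sub, map_mul, map_ofNat] at this
      simp only [Function.comp_apply, Pi.sub_apply, smul_eq_mul]
      rw [this]
      ring
    · simp only [Function.comp_apply, Pi.sub_apply, smul_eq_mul]
      rw [hE x (by simpa using hx)]
      simp [theta3Prod, sub_eq_add_neg, mul_assoc, pow_two]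
  obtain ⟨ψ, hψ, hcoeff⟩ := exists_hasIntExpansion ht_lim
  have hX (j : ℕ) : (X : ℤ[X]) ^ 3 ∣ X ^ (2 * (j + 1) + 1) := pow_dvd_pow _ (by lia)
  have hX' (j : ℕ) : (X : ℤ[X]) ^ 3 ∣ X ^ (2 * (j + 1) + 2) := pow_dvd_pow _ (by lia)
  have hX'' (j : ℕ) : (X : ℤ[X]) ^ 3 ∣ X ^ (4 * (j + 1) + 2) := pow_dvd_pow _ (by lia)
  have hp3 := dvd_prod_sub_zero (f := p) fun j =>
    dvd_triple_mul_sub_one (hX' j).neg_right (hX j) (hX j)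
  have he3 := dvd_prod_sub_zero (f := e) fun j =>
    dvd_triple_mul_sub_one (hX' j) (hX'' j).neg_right (dvd_zero _)
  have hdvd (N : ℕ) : (X : ℤ[X]) ^ 3 ∣ C 2 * (t (N + 1) - X) := by
    have h0 : p 0 - e 0 - 2 * X = (X : ℤ[X]) ^ 3 * (-2) := by
      simp only [hp_def, he_def]
      ring
    have := ((hp3 N).sub (he3 N)).add (Dvd.intro _ h0.symm)
    convert this using 1
    have h2 := ht (N + 1)
    rw [show (C 2 : ℤ[X]) = 2 from rfl]
    linear_combination -h2
  have hk (k : ℕ) (hk3 : k < 3) : ψ.coeff k = (X : ℤ[X]).coeff k := by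
    obtain ⟨N, hN, hN1⟩ := ((hcoeff k).and (eventually_ge_atTop 1)).exists
    obtain ⟨M, rfl⟩ := Nat.exists_eq_add_of_le' hN1
    have := X_pow_dvd_iff.mp (hdvd M) k hk3
    rw [coeff_C_mul, coeff_sub, hN] at this
    lia
  refine ⟨_, ψ, hψ, fun x _ => by ring, by simpa using hk 0 (by simp), by simpa using hk 1 (by simp),
    by simpa [coeff_X] using hk 2 (by simp)⟩

lemma norm_qpow_half_lt_one {τ : ℂ} (hτ : 0 < τ.im) : ‖qpow (1/2) τ‖ < 1 := by
  rw [qpow, Complex.norm_exp, Real.exp_lt_one_iff]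
  have : 2 * (Real.pi : ℂ) * Complex.I * (1 / 2) * τ = (Real.pi : ℂ) * (Complex.I * τ) := by ring
  rw [this, Complex.re_ofReal_mul]
  simpa using mul_pos Real.pi_pos hτ

lemma qpow_half_pow (n : ℕ) (τ : ℂ) : qpow (1/2) τ ^ n = qpow (n / 2) τ := by
  rw [qpow, qpow, ← Complex.exp_nat_mul]
  ring_nf

lemma jTheta3_zero (τ : ℂ) : jTheta3 0 τ = theta3Prod (qpow (1/2) τ) := by
  refine tprod_congr fun j => ?_
  rw [qpow_half_pow, qpow_half_pow]
  push_cast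
  rw [show ((2 * j + 2 : ℂ)) / 2 = j + 1 by ring, show ((2 * j + 1 : ℂ)) / 2 = j + 1 / 2 by ring]
  simp
  ring

lemma jTheta1_zero_pow_four (τ : ℂ) :
    jTheta1 0 τ ^ 4 = 16 * qpow (1/2) τ * theta1Prod (qpow (1/2) τ) ^ 4 := by
  have h8 : qpow (1/8) τ ^ 4 = qpow (1/2) τ := by
    rw [qpow, qpow, ← Complex.exp_nat_mul]
    ring_nf
  have h : jTheta1 0 τ = 2 * qpow (1/8) τ * theta1Prod (qpow (1/2) τ) := by
    rw [jTheta1, theta1Prod]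
    congr 1
    · simp
    · refine tprod_congr fun j => ?_
      rw [qpow_half_pow]
      push_cast
      rw [show ((2 * j + 2 : ℂ)) / 2 = j + 1 by ring]
      simp
      ring
  rw [h, mul_pow, mul_pow, h8]
  norm_num

end Expansions

/-- The expansions in powers of `q^{1/2} = e^{πiτ} = qpow (1/2) τ`:
`δ₂ = -1/8 - 3q^{1/2} - 3q + ⋯` and `ε₂ = q^{1/2} + 8q + ⋯`, where all the higher coefficients
are integers and the series converge absolutely on the upper half-plane.
Here `c n`, `d n` are the coefficients of `(q^{1/2})^(n+3) = q^{(n+3)/2}`. -/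
theorem delta2_epsilon2_q_expansions :
    ∃ c d : ℕ → ℤ, ∀ τ : ℂ, 0 < τ.im →
      (Summable fun n : ℕ => ‖(c n : ℂ) * qpow (1/2) τ ^ (n + 3)‖) ∧
      (Summable fun n : ℕ => ‖(d n : ℂ) * qpow (1/2) τ ^ (n + 3)‖) ∧
      delta2 τ = -(1/8) - 3 * qpow (1/2) τ - 3 * qpow (1/2) τ ^ 2 +
        ∑' n : ℕ, (c n : ℂ) * qpow (1/2) τ ^ (n + 3) ∧
      epsilon2 τ = qpow (1/2) τ + 8 * qpow (1/2) τ ^ 2 +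
        ∑' n : ℕ, (d n : ℂ) * qpow (1/2) τ ^ (n + 3) := by
  obtain ⟨φ, hφ, hφ0, hφ1⟩ := exists_hasIntExpansion_theta1Prod
  obtain ⟨g, ψ, hψ, hg, hψ0, hψ1, hψ2⟩ := exists_hasIntExpansion_theta3Prod
  obtain ⟨Δ, hΔ, hd⟩ : ∃ Δ, Δ = _ ∧ HasIntExpansion Δ _ := ⟨_, rfl,
    (HasIntExpansion.intCast (-1)).mul
    ((((HasIntExpansion.intCast 2).mul (HasIntExpansion.id.mul (hφ.pow 4))).add hψ).add
      ((((HasIntExpansion.intCast 3).mul (hψ.pow 2)).add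
        ((HasIntExpansion.intCast 4).mul (hψ.pow 3))).add
        ((HasIntExpansion.intCast 2).mul (hψ.pow 4))))⟩
  obtain ⟨E, hE, he⟩ : ∃ E, E = _ ∧ HasIntExpansion E _ := ⟨_, rfl,
    (HasIntExpansion.id.mul (hφ.pow 4)).mul
    (((HasIntExpansion.intCast 1).add ((HasIntExpansion.intCast 2).mul hψ)).pow 4)⟩
  rw [PowerSeries.coeff_zero_eq_constantCoeff_apply] at hφ0 hψ0
  have hΔ0 : Δ.coeff 0 = 0 := by simp [hΔ, hφ0, hψ0]
  have hΔ1 : Δ.coeff 1 = -3 := by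
    simp [-eq_intCast, hΔ, PowerSeries.coeff_mul, Finset.Nat.antidiagonal_succ, pow_succ, PowerSeries.coeff_X,
      PowerSeries.coeff_C, hφ0, hψ0, hψ1]
  have hΔ2 : Δ.coeff 2 = -3 := by
    simp [-eq_intCast, hΔ, PowerSeries.coeff_mul, Finset.Nat.antidiagonal_succ, pow_succ, PowerSeries.coeff_X,
      PowerSeries.coeff_C, hφ0, hψ0, hφ1, hψ1, hψ2]
  have hE0 : E.coeff 0 = 0 := by simp [hE]
  have hE1 : E.coeff 1 = 1 := by
    simp [-eq_intCast, hE, PowerSeries.coeff_mul, Finset.Nat.antidiagonal_succ, pow_succ, PowerSeries.coeff_X,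
      PowerSeries.coeff_C, hφ0, hψ0, hψ1]
  have hE2 : E.coeff 2 = 8 := by
    simp [-eq_intCast, hE, PowerSeries.coeff_mul, Finset.Nat.antidiagonal_succ, pow_succ, PowerSeries.coeff_X,
      PowerSeries.coeff_C, hφ0, hψ0, hφ1, hψ1, hψ2]
  refine ⟨fun n => Δ.coeff (n + 3), fun n => E.coeff (n + 3), fun τ hτ => ?_⟩
  have hx := norm_qpow_half_lt_one hτ
  have hds := hd.hasSum_tail hx
  have hes := he.hasSum_tail hx
  refine ⟨hds.summable.norm, hes.summable.norm, ?_, ?_⟩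
  · rw [hds.tsum_eq, delta2, jTheta1_zero_pow_four, jTheta3_zero, hg _ hx, hΔ0, hΔ1, hΔ2]
    simp only [Pi.mul_apply, Pi.add_apply, Pi.pow_apply]
    push_cast
    ring
  · rw [hes.tsum_eq, epsilon2, jTheta1_zero_pow_four, jTheta3_zero, hg _ hx, hE0, hE1, hE2]
    simp only [Pi.mul_apply, Pi.add_apply, Pi.pow_apply]
    push_cast
    ring
end
end

section
/- Let τ be in the upper half-plane ℍ and v ∈ ℂ be such that θ(v, −1/τ) ≠ 0 and θ(τv, τ) ≠ 0. Then v·θ'(0,−1/τ)·θ₂(v,−1/τ) / (θ(v,−1/τ)·θ₂(0,−1/τ)) = (τv)·θ'(0,τ)·θ₁(τv,τ) / (θ(τv,τ)·θ₁(0,τ)). (This is the transformation law under S: τ ↦ −1/τ of the factor appearing in the characteristic form P₂, relating it to the factor appearing in P₁.) -/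
open Complex

noncomputable section

open Filter Topology

/-- The finite `q`-Pochhammer symbol `(q; q)_n`. -/
def qPoch (q : ℂ) (n : ℕ) : ℂ := ∏ i ∈ Finset.range n, (1 - q ^ (i + 1))

/-- The inverse of the `q`-Pochhammer symbol `(q; q)_k`, extended by zero to negative `k`. -/
def qPochInv (q : ℂ) : ℤ → ℂ
  | .ofNat n => (qPoch q n)⁻¹
  | .negSucc _ => 0

lemma one_sub_pow_ne_zero {q : ℂ} (hq : ‖q‖ < 1) (n : ℕ) : 1 - q ^ (n + 1) ≠ 0 := by
  intro h
  have h1 : ‖q ^ (n + 1)‖ < 1 := by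
    rw [norm_pow]
    exact pow_lt_one₀ (norm_nonneg _) hq (by omega)
  rw [← sub_eq_zero.mp h] at h1
  simp at h1

lemma qPochInv_eq_mul {q : ℂ} (hq : ‖q‖ < 1) (k : ℤ) :
    qPochInv q k = (1 - q ^ (k + 1)) * qPochInv q (k + 1) := by
  rcases k with n | n
  · have h : Int.ofNat n + 1 = Int.ofNat (n + 1) := rfl
    have h' : q ^ (Int.ofNat (n + 1)) = q ^ (n + 1) := zpow_natCast q (n + 1)
    rw [h, h']
    simp only [qPochInv, qPoch, Finset.prod_range_succ, mul_inv]
    field_simp [one_sub_pow_ne_zero hq n]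
  · rcases n with _ | n
    · simp [qPochInv]
    · have h : Int.negSucc (n + 1) + 1 = Int.negSucc n := rfl
      rw [h]
      simp [qPochInv]

/-- The finite form of the Jacobi triple product identity. -/
lemma hasSum_finite_jacobi_triple {x w : ℂ} (hx : x ≠ 0) (hx1 : ‖x ^ 2‖ < 1) (hw : w ≠ 0) (N : ℕ) :
    HasSum (fun n : ℤ => qPoch (x ^ 2) (2 * N) *
        (qPochInv (x ^ 2) (N - n) * qPochInv (x ^ 2) (N + n)) * (x ^ (n ^ 2) * w ^ n))
      (∏ j ∈ Finset.range N, (1 + w * x ^ (2 * j + 1)) * (1 + w⁻¹ * x ^ (2 * j + 1))) := by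
  induction N with
  | zero =>
    convert hasSum_single (0 : ℤ) ?_ using 1
    · simp [qPoch, qPochInv]
    · intro n hn
      rcases n with n | n
      · rcases n with _ | n
        · exact absurd rfl hn
        · have : qPochInv (x ^ 2) ((0 : ℕ) - Int.ofNat (n + 1)) = 0 := by
            rw [show ((0 : ℕ) : ℤ) - Int.ofNat (n + 1) = Int.negSucc n by
              simp [Int.negSucc_eq]]
            rfl
          rw [this]; simp
      · have : qPochInv (x ^ 2) ((0 : ℕ) + Int.negSucc n) = 0 := by
          rw [show ((0 : ℕ) : ℤ) + Int.negSucc n = Int.negSucc n by simp]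
          rfl
        rw [this]; simp
  | succ N ih =>
    have hm := ((Equiv.subRight (1 : ℤ)).hasSum_iff).mpr ih
    have hp := ((Equiv.addRight (1 : ℤ)).hasSum_iff).mpr ih
    rw [Finset.prod_range_succ]
    have key := (ih.mul_left (1 + (x ^ (2 * N + 1)) ^ 2)).add
      ((hm.mul_left (x ^ (2 * N + 1) * w)).add (hp.mul_left (x ^ (2 * N + 1) * w⁻¹)))
    rw [← add_mul, ← add_mul] at key
    rw [show (1 + w * x ^ (2 * N + 1)) * (1 + w⁻¹ * x ^ (2 * N + 1)) =
      1 + (x ^ (2 * N + 1)) ^ 2 + (x ^ (2 * N + 1) * w + x ^ (2 * N + 1) * w⁻¹) by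
        field_simp
        ring, mul_comm (∏ j ∈ _, _)]
    refine Eq.subst (motive := fun f => HasSum f _) (funext fun n => Eq.symm ?_) key
    simp only [Function.comp, Equiv.subRight_apply, Equiv.coe_addRight]
    have hq : x ^ 2 ≠ 0 := pow_ne_zero _ hx
    set A := qPochInv (x ^ 2) (N + 1 - n) with hA
    set B := qPochInv (x ^ 2) (N + 1 + n) with hB
    have e1 : qPochInv (x ^ 2) (N - n) = (1 - (x ^ 2) ^ ((N : ℤ) - n + 1)) * A := by
      rw [qPochInv_eq_mul hx1, hA]; congr 2; ring
    have e2 : qPochInv (x ^ 2) (N + n) = (1 - (x ^ 2) ^ ((N : ℤ) + n + 1)) * B := by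
      rw [qPochInv_eq_mul hx1, hB]; congr 2; ring
    have e3 : qPochInv (x ^ 2) (N - (n + 1)) =
        (1 - (x ^ 2) ^ ((N : ℤ) - n)) * ((1 - (x ^ 2) ^ ((N : ℤ) - n + 1)) * A) := by
      rw [qPochInv_eq_mul hx1, ← e1]
      rw [show (N : ℤ) - (n + 1) + 1 = N - n by ring]
    have e4 : qPochInv (x ^ 2) (N + (n - 1)) =
        (1 - (x ^ 2) ^ ((N : ℤ) + n)) * ((1 - (x ^ 2) ^ ((N : ℤ) + n + 1)) * B) := by
      rw [qPochInv_eq_mul hx1, ← e2]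
      rw [show (N : ℤ) + (n - 1) + 1 = N + n by ring]
    have e5 : qPochInv (x ^ 2) (N - (n - 1)) = A := by rw [hA]; congr 1; ring
    have e6 : qPochInv (x ^ 2) (N + (n + 1)) = B := by rw [hB]; congr 1; ring
    have e7 : qPoch (x ^ 2) (2 * (N + 1)) =
        qPoch (x ^ 2) (2 * N) * (1 - (x ^ 2) ^ (2 * N + 1)) * (1 - (x ^ 2) ^ (2 * N + 2)) := by
      rw [show 2 * (N + 1) = 2 * N + 1 + 1 by ring]
      simp only [qPoch, Finset.prod_range_succ]
    have f1 : x ^ ((n - 1) ^ 2) = x ^ (n ^ 2) * (x ^ n)⁻¹ ^ 2 * x := by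
      rw [show (n - 1) ^ 2 = n ^ 2 + (-n) + (-n) + 1 by ring]
      simp only [zpow_add₀ hx, zpow_neg, zpow_one]; ring
    have f2 : x ^ ((n + 1) ^ 2) = x ^ (n ^ 2) * (x ^ n) ^ 2 * x := by
      rw [show (n + 1) ^ 2 = n ^ 2 + n + n + 1 by ring]
      simp only [zpow_add₀ hx, zpow_one]; ring
    have f3 : (x ^ 2) ^ n = (x ^ n) ^ 2 := by
      rw [← zpow_natCast, ← zpow_natCast, ← zpow_mul, ← zpow_mul, mul_comm]
    push_cast
    rw [← hA, ← hB, e1, e2, e3, e4, e5, e6, e7, f1, f2, zpow_sub_one₀ hw, zpow_add_one₀ hw]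
    simp only [zpow_sub₀ hq, zpow_add₀ hq, zpow_one, zpow_natCast, f3]
    have ht : x ^ n ≠ 0 := zpow_ne_zero _ hx
    have e : ∀ m : ℕ, (x ^ 2) ^ m = (x ^ m) ^ 2 := fun m => by rw [← pow_mul, ← pow_mul, mul_comm]
    generalize x ^ n = t at *
    generalize x ^ (n ^ 2) = s at *
    generalize w ^ n = u at *
    clear_value A B
    simp only [pow_add, pow_mul, e]
    field_simp
    ring

lemma tendsto_qPoch {q : ℂ} (hq : ‖q‖ < 1) :
    Tendsto (qPoch q) atTop (𝓝 (∏' n : ℕ, (1 - q ^ (n + 1)))) :=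
  (ModularForm.multipliable_one_sub_pow hq).tendsto_prod_tprod_nat

lemma tprod_one_sub_pow_ne_zero {q : ℂ} (hq : ‖q‖ < 1) : ∏' n : ℕ, (1 - q ^ (n + 1)) ≠ 0 := by
  refine tprod_one_add_ne_zero_of_summable (f := fun n => -q ^ (n + 1)) ?_ ?_
  · exact fun i => one_sub_pow_ne_zero hq i
  · simpa using (summable_nat_add_iff 1).mpr (summable_geometric_of_lt_one (norm_nonneg _) hq)

lemma tendsto_qPochInv {q : ℂ} (hq : ‖q‖ < 1) {u : ℕ → ℤ} (hu : Tendsto u atTop atTop) :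
    Tendsto (fun N => qPochInv q (u N)) atTop (𝓝 (∏' n : ℕ, (1 - q ^ (n + 1)))⁻¹) := by
  have h : Tendsto (fun n : ℕ => qPochInv q n) atTop (𝓝 (∏' n : ℕ, (1 - q ^ (n + 1)))⁻¹) :=
    (tendsto_qPoch hq).inv₀ (tprod_one_sub_pow_ne_zero hq)
  have h' : Tendsto (fun N => (u N).toNat) atTop atTop := by
    refine tendsto_atTop.mpr fun b => ?_
    filter_upwards [tendsto_atTop.mp hu b] with N hN
    omega
  refine (h.comp h').congr' ?_
  filter_upwards [tendsto_atTop.mp hu 0] with N hN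
  simp [Int.toNat_of_nonneg hN]

lemma exists_norm_qPoch_le {q : ℂ} (hq : ‖q‖ < 1) : ∃ C, ∀ n, ‖qPoch q n‖ ≤ C := by
  obtain ⟨C, hC⟩ := (Metric.isBounded_range_of_tendsto _ (tendsto_qPoch hq)).exists_norm_le
  exact ⟨C, fun n => hC _ ⟨n, rfl⟩⟩

lemma exists_norm_qPochInv_le {q : ℂ} (hq : ‖q‖ < 1) : ∃ C, ∀ k, ‖qPochInv q k‖ ≤ C := by
  obtain ⟨C, hC⟩ := (Metric.isBounded_range_of_tendsto _
    (tendsto_qPochInv hq tendsto_natCast_atTop_atTop)).exists_norm_le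
  refine ⟨C, fun k => ?_⟩
  rcases k with n | n
  · exact hC _ ⟨n, rfl⟩
  · have : 0 ≤ C := (norm_nonneg _).trans (hC _ ⟨0, rfl⟩)
    simpa [qPochInv] using this

/-- The Jacobi triple product identity. -/
lemma tendsto_jacobi_triple {x w : ℂ} (hx : x ≠ 0) (hx1 : ‖x ^ 2‖ < 1) (hw : w ≠ 0)
    (hs : Summable fun n : ℤ => x ^ (n ^ 2) * w ^ n) :
    Tendsto (fun N => ∏ j ∈ Finset.range N, (1 + w * x ^ (2 * j + 1)) * (1 + w⁻¹ * x ^ (2 * j + 1)))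
      atTop (𝓝 ((∏' n : ℕ, (1 - (x ^ 2) ^ (n + 1)))⁻¹ * ∑' n : ℤ, x ^ (n ^ 2) * w ^ n)) := by
  obtain ⟨C, hC⟩ := exists_norm_qPoch_le hx1
  obtain ⟨D, hD⟩ := exists_norm_qPochInv_le hx1
  have hC0 : 0 ≤ C := (norm_nonneg _).trans (hC 0)
  have hD0 : 0 ≤ D := (norm_nonneg _).trans (hD 0)
  have hP := tprod_one_sub_pow_ne_zero hx1
  rw [← tsum_mul_left]
  simp_rw [← fun N => (hasSum_finite_jacobi_triple hx hx1 hw N).tsum_eq]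
  refine tendsto_tsum_of_dominated_convergence
    (bound := fun n : ℤ => C * (D * D) * ‖x ^ (n ^ 2) * w ^ n‖) (hs.norm.mul_left _) ?_ ?_
  · intro n
    have h1 : Tendsto (fun N : ℕ => qPoch (x ^ 2) (2 * N)) atTop _ :=
      (tendsto_qPoch hx1).comp (tendsto_id.const_mul_atTop' two_pos)
    have h2 := tendsto_qPochInv hx1
      (tendsto_atTop_add_const_right _ (-n) (tendsto_natCast_atTop_atTop (R := ℤ)))
    have h3 := tendsto_qPochInv hx1
      (tendsto_atTop_add_const_right _ n (tendsto_natCast_atTop_atTop (R := ℤ)))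
    have h4 := (h1.mul (h2.mul h3)).mul_const (x ^ (n ^ 2) * w ^ n)
    rw [mul_inv_cancel_left₀ hP] at h4
    exact h4
  · refine .of_forall fun N n => ?_
    rw [norm_mul, norm_mul, norm_mul]
    gcongr
    · exact hC _
    · exact hD _
    · exact hD _

lemma qpow_add (s t τ : ℂ) : qpow (s + t) τ = qpow s τ * qpow t τ := by
  rw [qpow, qpow, qpow, ← Complex.exp_add]; ring_nf

lemma qpow_natCast_mul (n : ℕ) (s τ : ℂ) : qpow (n * s) τ = qpow s τ ^ n := by
  rw [qpow, qpow, ← Complex.exp_nat_mul]; ring_nf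

lemma norm_qpow_lt_one {s : ℝ} (hs : 0 < s) {τ : ℂ} (hτ : 0 < τ.im) : ‖qpow s τ‖ < 1 := by
  rw [qpow, Complex.norm_exp, Real.exp_lt_one_iff]
  have : 0 < Real.pi * s * τ.im := by positivity
  simp
  nlinarith

lemma multipliable_one_add_mul_qpow (c s : ℂ) {τ : ℂ} (hτ : 0 < τ.im) :
    Multipliable fun j : ℕ => 1 + c * qpow (j + s) τ := by
  refine multipliable_one_add_of_summable ?_
  have hq : ‖qpow 1 τ‖ < 1 := by simpa using norm_qpow_lt_one one_pos hτ
  have h := (summable_geometric_of_lt_one (norm_nonneg _) hq).mul_left ‖c * qpow s τ‖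
  refine h.congr fun j => ?_
  rw [qpow_add, ← mul_one (j : ℂ), qpow_natCast_mul]
  simp only [norm_mul, norm_pow]
  ring

lemma jTheta3_eq_jacobiTheta₂ (v : ℂ) {τ : ℂ} (hτ : 0 < τ.im) :
    jTheta3 v τ = jacobiTheta₂ v τ := by
  set x := qpow (1 / 2) τ with hx
  set w := Complex.exp (2 * (Real.pi : ℂ) * Complex.I * v) with hw
  have hx0 : x ≠ 0 := Complex.exp_ne_zero _
  have hx2 : x ^ 2 = qpow 1 τ := by
    rw [hx, ← qpow_natCast_mul]; norm_num
  have hx1 : ‖x ^ 2‖ < 1 := by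
    rw [hx2]; simpa using norm_qpow_lt_one one_pos hτ
  have hterm : ∀ n : ℤ, jacobiTheta₂_term n v τ = x ^ (n ^ 2) * w ^ n := fun n => by
    rw [jacobiTheta₂_term, hx, hw, qpow, ← Complex.exp_int_mul, ← Complex.exp_int_mul,
      ← Complex.exp_add]
    push_cast
    ring_nf
  have hs : Summable fun n : ℤ => x ^ (n ^ 2) * w ^ n :=
    ((summable_jacobiTheta₂_term_iff v τ).mpr hτ).congr hterm
  have h1 := tendsto_jacobi_triple hx0 hx1 (Complex.exp_ne_zero _) hs
  have h2 := (tendsto_qPoch hx1).mul h1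
  rw [mul_inv_cancel_left₀ (tprod_one_sub_pow_ne_zero hx1), ← tsum_congr hterm] at h2
  have hm := ((multipliable_one_add_mul_qpow (-1) 1 hτ).mul
    (multipliable_one_add_mul_qpow w (1 / 2) hτ)).mul
    (multipliable_one_add_mul_qpow w⁻¹ (1 / 2) hτ)
  refine Eq.trans (tprod_congr fun j => ?_)
    (tendsto_nhds_unique hm.tendsto_prod_tprod_nat (h2.congr fun N => ?_))
  · rw [Complex.exp_neg]; ring
  · rw [qPoch, ← Finset.prod_mul_distrib]
    refine Finset.prod_congr rfl fun j _ => ?_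
    have e1 : (x ^ 2) ^ (j + 1) = qpow (j + 1) τ := by
      rw [hx2, ← qpow_natCast_mul]; push_cast; ring_nf
    have e2 : x ^ (2 * j + 1) = qpow (j + 1 / 2) τ := by
      rw [hx, ← qpow_natCast_mul]; push_cast; ring_nf
    rw [e1, e2]
    ring

lemma exp_two_pi_I_mul_add_half (v : ℂ) :
    Complex.exp (2 * (Real.pi : ℂ) * Complex.I * (v + 1 / 2)) =
      -Complex.exp (2 * (Real.pi : ℂ) * Complex.I * v) := by
  rw [show 2 * (Real.pi : ℂ) * Complex.I * (v + 1 / 2) =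
      2 * (Real.pi : ℂ) * Complex.I * v + Real.pi * Complex.I by ring, Complex.exp_add,
      Complex.exp_pi_mul_I, mul_neg_one]

lemma jTheta2_eq_jacobiTheta₂ (v : ℂ) {τ : ℂ} (hτ : 0 < τ.im) :
    jTheta2 v τ = jacobiTheta₂ (v + 1 / 2) τ := by
  rw [← jTheta3_eq_jacobiTheta₂ _ hτ, jTheta2, jTheta3]
  refine tprod_congr fun j => ?_
  rw [Complex.exp_neg, Complex.exp_neg, exp_two_pi_I_mul_add_half, inv_neg]
  ring

lemma jTheta1_eq_jacobiTheta₂ (v : ℂ) {τ : ℂ} (hτ : 0 < τ.im) :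
    jTheta1 v τ = qpow (1 / 8) τ * Complex.exp (Real.pi * Complex.I * v) *
      jacobiTheta₂ (v + τ / 2) τ := by
  rw [← jTheta3_eq_jacobiTheta₂ _ hτ, jTheta1, jTheta3]
  set w := Complex.exp (2 * (Real.pi : ℂ) * Complex.I * v) with hw
  have e1 : ∀ j : ℕ, Complex.exp (2 * (Real.pi : ℂ) * Complex.I * (v + τ / 2)) *
      qpow (j + 1 / 2) τ = w * qpow (j + 1) τ := fun j => by
    rw [hw, qpow, qpow, ← Complex.exp_add, ← Complex.exp_add]; ring_nf
  have e2 : ∀ j : ℕ, Complex.exp (-(2 * (Real.pi : ℂ) * Complex.I * (v + τ / 2))) *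
      qpow (j + 1 / 2) τ = w⁻¹ * qpow (j + 0) τ := fun j => by
    rw [hw, ← Complex.exp_neg, qpow, qpow, ← Complex.exp_add, ← Complex.exp_add]; ring_nf
  have hm := ((multipliable_one_add_mul_qpow (-1) 1 hτ).mul
    (multipliable_one_add_mul_qpow w 1 hτ))
  have hm1 := multipliable_one_add_mul_qpow w⁻¹ 1 hτ
  have hm0 := multipliable_one_add_mul_qpow w⁻¹ 0 hτ
  simp_rw [e1, e2, Complex.exp_neg, ← hw, sub_eq_add_neg, ← neg_one_mul (qpow _ _)]
  have hj : ∀ j : ℕ, 1 + w⁻¹ * qpow ((j + 1 : ℕ) + 0) τ = 1 + w⁻¹ * qpow (j + 1) τ := fun j => by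
    push_cast; rw [add_zero]
  have hshift : ∏' j : ℕ, (1 + w⁻¹ * qpow (j + 0) τ) =
      (1 + w⁻¹) * ∏' j : ℕ, (1 + w⁻¹ * qpow (j + 1) τ) := by
    rw [tprod_eq_zero_mul' (hm1.congr fun j => (hj j).symm), tprod_congr hj]
    simp [qpow]
  rw [hm.tprod_mul hm1, hm.tprod_mul hm0, hshift]
  have hc : 2 * Complex.cos (Real.pi * v) =
      Complex.exp (Real.pi * Complex.I * v) * (1 + w⁻¹) := by
    rw [Complex.cos, hw, ← Complex.exp_neg, mul_add, ← Complex.exp_add]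
    ring_nf
  generalize (∏' j : ℕ, (1 + -1 * qpow (j + 1) τ) * (1 + w * qpow (j + 1) τ)) = A
  generalize (∏' j : ℕ, (1 + w⁻¹ * qpow (j + 1) τ)) = B
  linear_combination qpow (1 / 8) τ * (A * B) * hc

lemma jTheta_eq_neg_jTheta1 (v τ : ℂ) : jTheta v τ = -jTheta1 (v + 1 / 2) τ := by
  have hc : Complex.cos (Real.pi * (v + 1 / 2)) = -Complex.sin (Real.pi * v) := by
    rw [← Complex.cos_add_pi_div_two]; ring_nf
  rw [jTheta, jTheta1, hc, mul_neg, neg_mul, neg_neg]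
  simp_rw [Complex.exp_neg, exp_two_pi_I_mul_add_half, inv_neg, neg_mul, ← sub_eq_add_neg]

lemma jTheta_eq_jacobiTheta₂ (v : ℂ) {τ : ℂ} (hτ : 0 < τ.im) :
    jTheta v τ = -Complex.I * qpow (1 / 8) τ * Complex.exp (Real.pi * Complex.I * v) *
      jacobiTheta₂ (v + 1 / 2 + τ / 2) τ := by
  rw [jTheta_eq_neg_jTheta1, jTheta1_eq_jacobiTheta₂ _ hτ, mul_add, Complex.exp_add,
    show (Real.pi : ℂ) * Complex.I * (1 / 2) = Real.pi / 2 * Complex.I by ring,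
    Complex.exp_pi_div_two_mul_I]
  ring

lemma jTheta_zero (τ : ℂ) : jTheta 0 τ = 0 := by simp [jTheta]

lemma differentiable_jTheta {τ : ℂ} (hτ : 0 < τ.im) : Differentiable ℂ fun v => jTheta v τ := by
  simp_rw [jTheta_eq_jacobiTheta₂ _ hτ]
  intro v
  have h : DifferentiableAt ℂ (fun v => jacobiTheta₂ (v + 1 / 2 + τ / 2) τ) v :=
    (differentiableAt_jacobiTheta₂_fst _ hτ).comp (f := fun v => v + 1 / 2 + τ / 2) v (by fun_prop)
  fun_prop

/-- The automorphy factor of `jacobiTheta₂` under `τ ↦ -1 / τ`, without its exponential part. -/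
def thetaSFactor (τ : ℂ) : ℂ := (-Complex.I * τ) ^ (1 / 2 : ℂ)

lemma thetaSFactor_ne_zero {τ : ℂ} (hτ : τ ≠ 0) : thetaSFactor τ ≠ 0 := by
  simp [thetaSFactor, Complex.cpow_eq_zero_iff, hτ]

lemma jacobiTheta₂_S {τ : ℂ} (hτ : τ ≠ 0) (u : ℂ) :
    jacobiTheta₂ u (-1 / τ) =
      thetaSFactor τ * Complex.exp (Real.pi * Complex.I * τ * u ^ 2) * jacobiTheta₂ (τ * u) τ := by
  have h0 := thetaSFactor_ne_zero hτ
  rw [thetaSFactor] at h0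
  rw [jacobiTheta₂_functional_equation (τ * u) τ, mul_div_cancel_left₀ _ hτ, thetaSFactor,
    show -(Real.pi : ℂ) * Complex.I * (τ * u) ^ 2 / τ = -(Real.pi * Complex.I * τ * u ^ 2) by
      field_simp, Complex.exp_neg]
  field_simp [Complex.exp_ne_zero]

lemma neg_one_div_im_pos {τ : ℂ} (hτ : 0 < τ.im) : 0 < (-1 / τ).im := by
  rw [neg_div, one_div, Complex.neg_im, Complex.inv_im, neg_div, neg_neg]
  have : τ ≠ 0 := by rintro rfl; simp at hτ
  exact div_pos hτ (Complex.normSq_pos.mpr this)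

lemma jTheta2_S {τ : ℂ} (hτ : 0 < τ.im) (v : ℂ) :
    jTheta2 v (-1 / τ) =
      thetaSFactor τ * Complex.exp (Real.pi * Complex.I * τ * v ^ 2) * jTheta1 (τ * v) τ := by
  have h0 : τ ≠ 0 := by rintro rfl; simp at hτ
  rw [jTheta2_eq_jacobiTheta₂ _ (neg_one_div_im_pos hτ), jacobiTheta₂_S h0,
    jTheta1_eq_jacobiTheta₂ _ hτ, show τ * (v + 1 / 2) = τ * v + τ / 2 by ring]
  have he : Complex.exp (Real.pi * Complex.I * τ * (v + 1 / 2) ^ 2) =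
      Complex.exp (Real.pi * Complex.I * τ * v ^ 2) *
        (qpow (1 / 8) τ * Complex.exp (Real.pi * Complex.I * (τ * v))) := by
    rw [qpow]
    simp only [← Complex.exp_add]
    ring_nf
  rw [he]
  ring

lemma jTheta_S {τ : ℂ} (hτ : 0 < τ.im) (v : ℂ) :
    jTheta v (-1 / τ) = -Complex.I * thetaSFactor τ *
      Complex.exp (Real.pi * Complex.I * τ * v ^ 2) * jTheta (τ * v) τ := by
  have h0 : τ ≠ 0 := by rintro rfl; simp at hτ
  have hz : τ * (v + 1 / 2 + -1 / τ / 2) + 1 = τ * v + 1 / 2 + τ / 2 := by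
    field_simp
    ring
  rw [jTheta_eq_jacobiTheta₂ _ (neg_one_div_im_pos hτ), jacobiTheta₂_S h0,
    jTheta_eq_jacobiTheta₂ _ hτ, ← jacobiTheta₂_add_left, hz]
  have he : qpow (1 / 8) (-1 / τ) * Complex.exp (Real.pi * Complex.I * v) *
      Complex.exp (Real.pi * Complex.I * τ * (v + 1 / 2 + -1 / τ / 2) ^ 2) =
      -Complex.I * (Complex.exp (Real.pi * Complex.I * τ * v ^ 2) *
        (qpow (1 / 8) τ * Complex.exp (Real.pi * Complex.I * (τ * v)))) := by
    rw [← Complex.exp_neg_pi_div_two_mul_I, qpow, qpow]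
    simp only [← Complex.exp_add]
    congr 1
    field_simp
    ring
  linear_combination -Complex.I * thetaSFactor τ * jacobiTheta₂ (τ * v + 1 / 2 + τ / 2) τ * he

lemma jThetaDeriv_S {τ : ℂ} (hτ : 0 < τ.im) :
    jThetaDeriv (-1 / τ) = -Complex.I * thetaSFactor τ * τ * jThetaDeriv τ := by
  rw [jThetaDeriv]
  simp_rw [jTheta_S hτ]
  have h1 : HasDerivAt (fun v => jTheta v τ) (jThetaDeriv τ) (τ * 0) := by
    rw [mul_zero]; exact (differentiable_jTheta hτ 0).hasDerivAt
  have h2 := h1.comp (0 : ℂ) ((hasDerivAt_id (0 : ℂ)).const_mul τ)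
  have h3 : DifferentiableAt ℂ (fun v : ℂ => -Complex.I * thetaSFactor τ *
      Complex.exp (Real.pi * Complex.I * τ * v ^ 2)) 0 := by fun_prop
  refine (h3.hasDerivAt.mul h2).deriv.trans ?_
  simp [jTheta_zero]
  ring

/-- Transformation under `S : τ ↦ -1/τ` of the factor appearing in the characteristic form `P₂`:
`v θ'(0,-1/τ) θ₂(v,-1/τ) / (θ(v,-1/τ) θ₂(0,-1/τ)) = (τv) θ'(0,τ) θ₁(τv,τ) / (θ(τv,τ) θ₁(0,τ))`. -/
theorem P2_factor_S_transformation (τ : ℂ) (hτ : 0 < τ.im) (v : ℂ)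
    (h1 : jTheta v (-1 / τ) ≠ 0) (h2 : jTheta (τ * v) τ ≠ 0) :
    v * jThetaDeriv (-1 / τ) * jTheta2 v (-1 / τ) /
        (jTheta v (-1 / τ) * jTheta2 0 (-1 / τ)) =
      (τ * v) * jThetaDeriv τ * jTheta1 (τ * v) τ /
        (jTheta (τ * v) τ * jTheta1 0 τ) := by
  have h0 : τ ≠ 0 := by rintro rfl; simp at hτ
  have hK := thetaSFactor_ne_zero h0
  have hE : Complex.exp (Real.pi * Complex.I * τ * v ^ 2) ≠ 0 := Complex.exp_ne_zero _
  rw [jThetaDeriv_S hτ, jTheta2_S hτ, jTheta2_S hτ, jTheta_S hτ]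
  simp only [mul_zero, ne_eq, OfNat.ofNat_ne_zero, not_false_eq_true, zero_pow, Complex.exp_zero,
    mul_one]
  rw [← mul_div_mul_left (τ * v * jThetaDeriv τ * jTheta1 (τ * v) τ) _
    (mul_ne_zero (mul_ne_zero (neg_ne_zero.mpr Complex.I_ne_zero) (pow_ne_zero 2 hK)) hE)]
  congr 1 <;> ring
end
end
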